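/- Let Ω⁺ ⊂ ℝ³ be a bounded open set with |Ω⁺| = m > 0. For λ > 0 let u_λ be the unique minimizer of the relaxed problem min{ 𝓔(u) : u ∈ L¹(ℝ³;[0,1]), u = 0 a.e. on Ω⁺, ∫ u ≤ λ }. Then ∫_{ℝ³} u_λ dx = min{λ, m}, and for every λ ≥ m one has u_λ = u_m almost everywhere. -/

import Mathlib

open MeasureTheory Real Filter

noncomputable section

abbrev E3 := EuclideanSpace ℝ (Fin 3)

/-- The Coulomb kernel in ℝ³. -/
def coul (x y : E3) : ℝ := 1 / (4 * π * ‖x - y‖)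

/-- The potential generated by the charge density `χ_{Ω⁺} − u`. -/
def potentialU (Ωp : Set E3) (u : E3 → ℝ) (x : E3) : ℝ :=
  ∫ y, (Set.indicator Ωp (fun _ => (1:ℝ)) y - u y) * coul x y

/-- The relaxed Coulomb energy
`𝓔(u) = ∫∫ (χ_{Ω⁺}−u)(x) (χ_{Ω⁺}−u)(y) / (4π|x−y|) dx dy`. -/
def relEnergy (Ωp : Set E3) (u : E3 → ℝ) : ℝ :=
  ∫ x, ∫ y, (Set.indicator Ωp (fun _ => (1:ℝ)) x - u x) *
    ((Set.indicator Ωp (fun _ => (1:ℝ)) y - u y) * coul x y)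

/-- Admissible relaxed densities: `u ∈ L¹(ℝ³;[0,1])`, `u = 0` a.e. on `Ω⁺`,
`∫ u ≤ λ`. -/
def RelAdm (Ωp : Set E3) (lam : ℝ) (u : E3 → ℝ) : Prop :=
  Integrable u ∧ (∀ᵐ x, 0 ≤ u x ∧ u x ≤ 1) ∧ (∀ᵐ x, x ∈ Ωp → u x = 0) ∧
    ∫ x, u x ≤ lam

open Topology

/-- The heat kernel of `ℝ³`. -/
def heatK (t : ℝ) (z : E3) : ℝ :=
  (4 * π * t) ^ (-(3 / 2) : ℝ) * exp (-‖z‖ ^ 2 / (4 * t))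

lemma heatK_pos {t : ℝ} (ht : 0 < t) (z : E3) : 0 < heatK t z := by
  unfold heatK; positivity

lemma heatK_le {t : ℝ} (ht : 0 < t) (z : E3) : heatK t z ≤ (4 * π * t) ^ (-(3 / 2) : ℝ) := by
  unfold heatK
  refine mul_le_of_le_one_right (by positivity) (exp_le_one_iff.2 ?_)
  rw [neg_div]
  exact neg_nonpos.2 (by positivity)

lemma heatK_sub_comm (t : ℝ) (x y : E3) : heatK t (x - y) = heatK t (y - x) := by
  unfold heatK; rw [norm_sub_rev]

lemma measurable_heatK : Measurable fun q : ℝ × E3 => heatK q.1 q.2 := by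
  unfold heatK
  fun_prop

lemma continuous_heatK (t : ℝ) : Continuous (heatK t) := by
  unfold heatK
  fun_prop

lemma integral_heatK {t : ℝ} (ht : 0 < t) : ∫ z, heatK t z = 1 := by
  have h := GaussianFourier.integral_rexp_neg_mul_sq_norm (V := E3) (b := 1 / (4 * t))
    (by positivity)
  have e : ∀ z : E3, heatK t z =
      (4 * π * t) ^ (-(3 / 2) : ℝ) * exp (-(1 / (4 * t)) * ‖z‖ ^ 2) := by
    intro z
    unfold heatK
    congr 2
    ring
  simp_rw [e]
  rw [integral_const_mul, h, finrank_euclideanSpace, Fintype.card_fin, rpow_neg (by positivity)]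
  have : π / (1 / (4 * t)) = 4 * π * t := by field_simp
  rw [this]
  push_cast
  exact inv_mul_cancel₀ (by positivity)

lemma integrable_heatK {t : ℝ} (ht : 0 < t) : Integrable (heatK t) :=
  .of_integral_ne_zero (by rw [integral_heatK ht]; exact one_ne_zero)

lemma integral_heatK_sub {t : ℝ} (ht : 0 < t) (x : E3) : ∫ z, heatK t (x - z) = 1 := by
  rw [integral_sub_left_eq_self (heatK t) volume x, integral_heatK ht]

lemma integrable_heatK_sub {t : ℝ} (ht : 0 < t) (x : E3) : Integrable fun z => heatK t (x - z) :=
  (integrable_heatK ht).comp_sub_left x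

lemma heatK_mul_heatK {t s : ℝ} (ht : 0 < t) (hs : 0 < s) (x y z : E3) :
    heatK t (x - z) * heatK s (z - y) =
      heatK (t * s / (t + s)) (z - (t + s)⁻¹ • (s • x + t • y)) * heatK (t + s) (x - y) := by
  unfold heatK
  rw [mul_mul_mul_comm, mul_mul_mul_comm ((4 * π * (t * s / (t + s))) ^ (-(3 / 2) : ℝ)),
    ← mul_rpow (by positivity) (by positivity),
    ← mul_rpow (by positivity) (by positivity), ← exp_add, ← exp_add]
  have h1 : 4 * π * (t * s / (t + s)) * (4 * π * (t + s)) = 4 * π * t * (4 * π * s) := by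
    field_simp
  rw [h1]
  congr 2
  simp only [EuclideanSpace.norm_sq_eq, Fin.sum_univ_three, PiLp.sub_apply, PiLp.smul_apply,
    PiLp.add_apply, smul_eq_mul, norm_eq_abs, sq_abs]
  field_simp
  ring

lemma integral_heatK_mul_heatK {t s : ℝ} (ht : 0 < t) (hs : 0 < s) (x y : E3) :
    ∫ z, heatK t (x - z) * heatK s (z - y) = heatK (t + s) (x - y) := by
  simp_rw [heatK_mul_heatK ht hs x y]
  rw [integral_mul_const, integral_sub_right_eq_self (heatK _), integral_heatK (by positivity),
    one_mul]

lemma integral_Ioi_heatK {z : E3} (hz : z ≠ 0) :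
    ∫ t in Set.Ioi (0 : ℝ), heatK t z = 1 / (4 * π * ‖z‖) := by
  have hr : 0 < ‖z‖ := norm_pos_iff.2 hz
  rw [← integral_comp_rpow_Ioi (fun t => heatK t z) (p := -1) (by norm_num)]
  have h := Real.integral_rpow_mul_exp_neg_mul_Ioi (a := 1 / 2) (r := ‖z‖ ^ 2 / 4)
    (by norm_num) (by positivity)
  have e : ∀ x ∈ Set.Ioi (0 : ℝ), (|(-1 : ℝ)| * x ^ ((-1 : ℝ) - 1)) • heatK (x ^ (-1 : ℝ)) z =
      (4 * π) ^ (-(3 / 2) : ℝ) * (x ^ ((1 / 2 : ℝ) - 1) * exp (-(‖z‖ ^ 2 / 4 * x))) := by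
    intro x hx
    have hx : 0 < x := hx
    unfold heatK
    rw [mul_rpow (by positivity) (by positivity), ← rpow_mul hx.le, rpow_neg_one]
    have e1 : -‖z‖ ^ 2 / (4 * x⁻¹) = -(‖z‖ ^ 2 / 4 * x) := by field_simp
    have e2 : x ^ ((1 / 2 : ℝ) - 1) = x ^ ((-1 : ℝ) - 1) * x ^ ((-1 : ℝ) * -(3 / 2)) := by
      rw [← rpow_add hx]; norm_num
    rw [e1, e2]
    simp only [abs_neg, abs_one, smul_eq_mul]
    ring
  rw [setIntegral_congr_fun measurableSet_Ioi e, integral_const_mul, h, Real.Gamma_one_half_eq]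
  have e3 : (1 / (‖z‖ ^ 2 / 4)) ^ (1 / 2 : ℝ) = 2 / ‖z‖ := by
    rw [← sqrt_eq_rpow, sqrt_eq_iff_mul_self_eq (by positivity) (by positivity)]
    field_simp
    norm_num
  have e4 : (4 * π) ^ (-(3 / 2) : ℝ) = 1 / (8 * π * √π) := by
    rw [rpow_neg (by positivity), ← one_div]
    congr 1
    have : (3 / 2 : ℝ) = 1 + 1 / 2 := by norm_num
    rw [this, rpow_add (by positivity), rpow_one, ← sqrt_eq_rpow,
      sqrt_mul (by norm_num) π, show (4 : ℝ) = 2 ^ 2 by norm_num, sqrt_sq (by norm_num)]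
    ring
  rw [e3, e4]
  have : 0 < √π := by positivity
  field_simp
  norm_num

/-- The heat flow of `f` at time `t`. -/
def heatP (f : E3 → ℝ) (t : ℝ) (x : E3) : ℝ := ∫ y, f y * heatK t (x - y)

/-- The Newtonian potential of `f`. -/
def newt (f : E3 → ℝ) (x : E3) : ℝ := ∫ y, f y * coul x y

/-- Integrable and essentially bounded functions. -/
def BddL1 (f : E3 → ℝ) : Prop := Integrable f ∧ ∃ B, ∀ᵐ x, |f x| ≤ B

lemma BddL1.add {f g : E3 → ℝ} (hf : BddL1 f) (hg : BddL1 g) : BddL1 fun x => f x + g x := by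
  obtain ⟨hf, B, hB⟩ := hf
  obtain ⟨hg, C, hC⟩ := hg
  refine ⟨hf.add hg, B + C, ?_⟩
  filter_upwards [hB, hC] with x h1 h2
  exact (abs_add_le _ _).trans (add_le_add h1 h2)

lemma BddL1.const_mul {f : E3 → ℝ} (hf : BddL1 f) (c : ℝ) : BddL1 fun x => c * f x := by
  obtain ⟨hf, B, hB⟩ := hf
  refine ⟨hf.const_mul c, |c| * B, ?_⟩
  filter_upwards [hB] with x h1
  rw [abs_mul]
  gcongr

lemma BddL1.sub {f g : E3 → ℝ} (hf : BddL1 f) (hg : BddL1 g) : BddL1 fun x => f x - g x := by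
  simpa [sub_eq_add_neg] using hf.add (hg.const_mul (-1))

lemma norm_heatK_le {t : ℝ} (ht : 0 < t) (z : E3) :
    ‖heatK t z‖ ≤ (4 * π * t) ^ (-(3 / 2) : ℝ) := by
  rw [norm_eq_abs, abs_of_pos (heatK_pos ht z)]
  exact heatK_le ht z

lemma integrable_mul_heatK {f : E3 → ℝ} (hf : Integrable f) {t : ℝ} (ht : 0 < t) (x : E3) :
    Integrable fun y => f y * heatK t (x - y) :=
  hf.mul_bdd (((continuous_heatK t).comp (by fun_prop)).aestronglyMeasurable)
    (.of_forall fun _ => norm_heatK_le ht _)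

lemma abs_heatP_le_heatP_abs (f : E3 → ℝ) {t : ℝ} (ht : 0 < t) (x : E3) :
    |heatP f t x| ≤ heatP (fun y => |f y|) t x := by
  unfold heatP
  refine abs_integral_le_integral_abs.trans_eq (integral_congr_ae (.of_forall fun y => ?_))
  simp only [abs_mul, abs_of_pos (heatK_pos ht _)]

lemma heatP_abs_le {f : E3 → ℝ} (hf : Integrable f) {t : ℝ} (ht : 0 < t) (x : E3) :
    heatP (fun y => |f y|) t x ≤ (4 * π * t) ^ (-(3 / 2) : ℝ) * ∫ y, |f y| := by
  unfold heatP
  rw [mul_comm, ← integral_mul_const]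
  refine integral_mono (integrable_mul_heatK hf.abs ht x) (hf.abs.mul_const _) fun y => ?_
  exact mul_le_mul_of_nonneg_left (heatK_le ht _) (abs_nonneg _)

lemma exists_heatP_bound {f : E3 → ℝ} (hf : BddL1 f) :
    ∃ b : ℝ → ℝ, IntegrableOn b (Set.Ioi 0) ∧
      ∀ t, 0 < t → ∀ x, heatP (fun y => |f y|) t x ≤ b t := by
  obtain ⟨hf, B, hB⟩ := hf
  set A := (4 * π) ^ (-(3 / 2) : ℝ) * ∫ y, |f y|
  refine ⟨fun t => if t ≤ 1 then B else t ^ (-(3 / 2) : ℝ) * A, ?_, fun t ht x => ?_⟩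
  · rw [← Set.Ioc_union_Ioi_eq_Ioi zero_le_one]
    refine IntegrableOn.union ?_ ?_
    · refine (integrableOn_const (C := B) (by simp) (by simp)).congr_fun (fun t ht => ?_)
        measurableSet_Ioc
      simp [ht.2]
    · have h : IntegrableOn (fun t : ℝ => t ^ (-(3 / 2) : ℝ) * A) (Set.Ioi 1) :=
        (integrableOn_Ioi_rpow_of_lt (by norm_num) zero_lt_one).mul_const A
      refine h.congr_fun (fun t ht => ?_) measurableSet_Ioi
      simp only [if_neg (not_le.2 (Set.mem_Ioi.1 ht))]
  · beta_reduce
    split_ifs with h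
    · have : ∫ y, B * heatK t (x - y) = B := by
        rw [integral_const_mul, integral_heatK_sub ht, mul_one]
      rw [← this]
      refine integral_mono_ae (integrable_mul_heatK hf.abs ht x)
        ((integrable_heatK_sub ht x).const_mul _) ?_
      filter_upwards [hB] with y hy
      exact mul_le_mul_of_nonneg_right hy (heatK_pos ht _).le
    · refine (heatP_abs_le hf ht x).trans_eq ?_
      rw [mul_rpow (by positivity) ht.le]
      ring

lemma aestronglyMeasurable_mul_heatK {f : E3 → ℝ} (hf : Integrable f) (x : E3) (μ : Measure ℝ)
    [SFinite μ] :
    AEStronglyMeasurable (fun q : ℝ × E3 => f q.2 * heatK q.1 (x - q.2)) (μ.prod volume) := by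
  refine hf.1.comp_snd.mul (Measurable.aestronglyMeasurable ?_)
  exact measurable_heatK.comp (measurable_fst.prodMk (measurable_const.sub measurable_snd))

lemma integrable_prod_mul_heatK {f : E3 → ℝ} (hf : BddL1 f) (x : E3) :
    Integrable (fun q : ℝ × E3 => f q.2 * heatK q.1 (x - q.2))
      ((volume.restrict (Set.Ioi 0)).prod volume) := by
  obtain ⟨b, hb, hfb⟩ := exists_heatP_bound hf
  have hm := aestronglyMeasurable_mul_heatK hf.1 x (volume.restrict (Set.Ioi 0))
  refine (integrable_prod_iff hm).2 ⟨?_, ?_⟩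
  · filter_upwards [ae_restrict_mem measurableSet_Ioi] with t ht
    exact integrable_mul_heatK hf.1 ht x
  · refine hb.mono' hm.norm.integral_prod_right' ?_
    filter_upwards [ae_restrict_mem measurableSet_Ioi] with t ht
    rw [norm_eq_abs, abs_of_nonneg (integral_nonneg fun _ => norm_nonneg _)]
    refine le_trans (le_of_eq ?_) (hfb t ht x)
    unfold heatP
    refine integral_congr_ae (.of_forall fun y => ?_)
    simp only [norm_mul, norm_eq_abs, abs_of_pos (heatK_pos ht _)]

lemma integral_Ioi_mul_heatK_ae (f : E3 → ℝ) (x : E3) :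
    ∀ᵐ y, ∫ t in Set.Ioi (0 : ℝ), f y * heatK t (x - y) = f y * coul x y := by
  filter_upwards [compl_mem_ae_iff.2 (measure_singleton (μ := (volume : Measure E3)) x)] with y hy
  have hxy : x - y ≠ 0 := sub_ne_zero.2 (Ne.symm hy)
  rw [integral_const_mul, integral_Ioi_heatK hxy, coul]

lemma integrable_mul_coul {f : E3 → ℝ} (hf : BddL1 f) (x : E3) :
    Integrable fun y => f y * coul x y :=
  (integrable_prod_mul_heatK hf x).integral_prod_right.congr (integral_Ioi_mul_heatK_ae f x)

lemma newt_eq {f : E3 → ℝ} (hf : BddL1 f) (x : E3) :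
    newt f x = ∫ t in Set.Ioi (0 : ℝ), heatP f t x := by
  unfold newt heatP
  rw [integral_integral_swap (f := fun t y => f y * heatK t (x - y))
    (integrable_prod_mul_heatK hf x)]
  exact integral_congr_ae ((integral_Ioi_mul_heatK_ae f x).mono fun y hy => hy.symm)

lemma integrableOn_heatP {f : E3 → ℝ} (hf : BddL1 f) (x : E3) :
    IntegrableOn (fun t => heatP f t x) (Set.Ioi 0) :=
  (integrable_prod_mul_heatK hf x).integral_prod_left

lemma continuous_heatP {f : E3 → ℝ} (hf : Integrable f) {t : ℝ} (ht : 0 < t) :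
    Continuous (heatP f t) := by
  unfold heatP
  refine continuous_of_dominated (bound := fun y => |f y| * (4 * π * t) ^ (-(3 / 2) : ℝ))
    (fun x => (integrable_mul_heatK hf ht x).1) (fun x => .of_forall fun y => ?_)
    (hf.abs.mul_const _) (.of_forall fun y => ?_)
  · rw [norm_mul]
    exact mul_le_mul_of_nonneg_left (norm_heatK_le ht _) (norm_nonneg _)
  · exact continuous_const.mul ((continuous_heatK t).comp (by fun_prop))

lemma tendsto_heatK_cobounded {t : ℝ} (ht : 0 < t) (n : ℕ) :
    Tendsto (fun z => ‖z‖ ^ n * heatK t z) (Bornology.cobounded E3) (𝓝 0) := by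
  have h := (tendsto_rpow_abs_mul_exp_neg_mul_sq_cocompact
    (a := 1 / (4 * t)) (by positivity) n).mono_left atTop_le_cocompact
  have h2 := (h.comp (tendsto_norm_cobounded_atTop (E := E3))).const_mul ((4 * π * t) ^ (-(3 / 2) : ℝ))
  rw [mul_zero] at h2
  refine h2.congr fun z => ?_
  simp only [Function.comp, abs_norm, rpow_natCast, heatK]
  rw [show -(1 / (4 * t)) * ‖z‖ ^ 2 = -‖z‖ ^ 2 / (4 * t) by ring]
  ring

lemma isCountablyGenerated_cocompact_E3 : (cocompact E3).IsCountablyGenerated := by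
  rw [← Metric.cobounded_eq_cocompact, ← comap_norm_atTop]
  infer_instance

lemma tendsto_heatP_cocompact {f : E3 → ℝ} (hf : Integrable f) {t : ℝ} (ht : 0 < t) :
    Tendsto (heatP f t) (cocompact E3) (𝓝 0) := by
  have := isCountablyGenerated_cocompact_E3
  rw [show (0 : ℝ) = ∫ y : E3, f y * 0 by simp]
  unfold heatP
  refine tendsto_integral_filter_of_dominated_convergence
    (fun y => |f y| * (4 * π * t) ^ (-(3 / 2) : ℝ))
    (.of_forall fun x => (integrable_mul_heatK hf ht x).1)
    (.of_forall fun x => .of_forall fun y => ?_)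
    (hf.abs.mul_const _) (.of_forall fun y => ?_)
  · rw [norm_mul]
    exact mul_le_mul_of_nonneg_left (norm_heatK_le ht _) (norm_nonneg _)
  · have h1 : Tendsto (fun x : E3 => x - y) (cocompact E3) (cocompact E3) :=
      (Homeomorph.subRight y).isClosedEmbedding.tendsto_cocompact
    have h2 := tendsto_heatK_cobounded ht 0
    rw [Metric.cobounded_eq_cocompact] at h2
    simpa using (h2.comp h1).const_mul (f y)

lemma exists_abs_newt_le {f : E3 → ℝ} (hf : BddL1 f) : ∃ M, 0 ≤ M ∧ ∀ x, |newt f x| ≤ M := by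
  obtain ⟨b, hb, hfb⟩ := exists_heatP_bound hf
  have h : ∀ x, |newt f x| ≤ ∫ t in Set.Ioi 0, b t := fun x => by
    rw [newt_eq hf, ← norm_eq_abs]
    refine norm_integral_le_of_norm_le hb ?_
    filter_upwards [ae_restrict_mem measurableSet_Ioi] with t ht
    exact (abs_heatP_le_heatP_abs f ht x).trans (hfb t ht x)
  exact ⟨_, (abs_nonneg _).trans (h 0), h⟩

lemma continuous_newt {f : E3 → ℝ} (hf : BddL1 f) : Continuous (newt f) := by
  obtain ⟨b, hb, hfb⟩ := exists_heatP_bound hf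
  rw [show newt f = fun x => ∫ t in Set.Ioi (0 : ℝ), heatP f t x from funext (newt_eq hf)]
  refine continuous_of_dominated (fun x => (integrableOn_heatP hf x).1) (fun x => ?_) hb ?_
  · filter_upwards [ae_restrict_mem measurableSet_Ioi] with t ht
    exact (abs_heatP_le_heatP_abs f ht x).trans (hfb t ht x)
  · filter_upwards [ae_restrict_mem measurableSet_Ioi] with t ht
    exact continuous_heatP hf.1 ht

lemma tendsto_newt_cocompact {f : E3 → ℝ} (hf : BddL1 f) :
    Tendsto (newt f) (cocompact E3) (𝓝 0) := by
  obtain ⟨b, hb, hfb⟩ := exists_heatP_bound hf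
  rw [show newt f = fun x => ∫ t in Set.Ioi (0 : ℝ), heatP f t x from funext (newt_eq hf)]
  have := isCountablyGenerated_cocompact_E3
  have h0 : 𝓝 (0 : ℝ) = 𝓝 (∫ t in Set.Ioi (0 : ℝ), (0 : ℝ)) := by simp
  rw [h0]
  refine tendsto_integral_filter_of_dominated_convergence b
    (.of_forall fun x => (integrableOn_heatP hf x).1) (.of_forall fun x => ?_) hb ?_
  · filter_upwards [ae_restrict_mem measurableSet_Ioi] with t ht
    exact (abs_heatP_le_heatP_abs f ht x).trans (hfb t ht x)
  · filter_upwards [ae_restrict_mem measurableSet_Ioi] with t ht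
    exact tendsto_heatP_cocompact hf.1 ht

lemma integrable_prod_mul_mul_heatK {f g : E3 → ℝ} (hf : Integrable f) (hg : Integrable g) {t : ℝ}
    (ht : 0 < t) : Integrable (fun q : E3 × E3 => f q.1 * g q.2 * heatK t (q.1 - q.2))
      (volume.prod volume) :=
  (hf.mul_prod hg).mul_bdd (((continuous_heatK t).comp (by fun_prop)).aestronglyMeasurable)
    (.of_forall fun _ => norm_heatK_le ht _)

lemma integral_mul_heatP_comm {f g : E3 → ℝ} (hf : Integrable f) (hg : Integrable g) {t : ℝ}
    (ht : 0 < t) : ∫ x, f x * heatP g t x = ∫ x, g x * heatP f t x := by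
  have h := integral_integral_swap (f := fun x y => f x * g y * heatK t (x - y))
    (integrable_prod_mul_mul_heatK hf hg ht)
  have e1 : ∀ x y, f x * (g y * heatK t (x - y)) = f x * g y * heatK t (x - y) :=
    fun x y => (mul_assoc _ _ _).symm
  have e2 : ∀ x y, g x * (f y * heatK t (x - y)) = f y * g x * heatK t (y - x) := fun x y => by
    rw [heatK_sub_comm]; ring
  unfold heatP
  simp_rw [← integral_const_mul, e1, e2]
  exact h

lemma heatP_heatP {f : E3 → ℝ} (hf : Integrable f) {s t : ℝ} (hs : 0 < s) (ht : 0 < t) (x : E3) :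
    heatP (heatP f s) t x = heatP f (t + s) x := by
  have h := integral_mul_heatP_comm (integrable_heatK_sub ht x) hf hs
  have e : ∀ y, heatP (fun z => heatK t (x - z)) s y = heatK (t + s) (x - y) := fun y => by
    rw [← integral_heatK_mul_heatK ht hs x y, heatP]
    simp_rw [heatK_sub_comm s y]
  simp_rw [e] at h
  rw [heatP, heatP, ← h]
  simp_rw [mul_comm]

lemma bddL1_heatP {f : E3 → ℝ} (hf : Integrable f) {t : ℝ} (ht : 0 < t) :
    BddL1 (heatP f t) := by
  refine ⟨?_, _, .of_forall fun x => (abs_heatP_le_heatP_abs f ht x).trans (heatP_abs_le hf ht x)⟩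
  have hm : AEStronglyMeasurable (fun q : E3 × E3 => f q.2 * heatK t (q.1 - q.2))
      (volume.prod volume) :=
    hf.1.comp_snd.mul ((continuous_heatK t).comp (by fun_prop)).aestronglyMeasurable
  refine Integrable.integral_prod_left ((integrable_prod_iff' hm).2 ⟨.of_forall fun y => ?_, ?_⟩)
  · exact ((integrable_heatK ht).comp_sub_right y).const_mul (f y)
  · refine hf.abs.congr (.of_forall fun y => ?_)
    simp only [norm_mul, norm_eq_abs, abs_of_pos (heatK_pos ht _)]
    rw [integral_const_mul, integral_sub_right_eq_self (heatK t), integral_heatK ht, mul_one]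

lemma aestronglyMeasurable_heatP {f : E3 → ℝ} (hf : Integrable f) (μ : Measure ℝ) [SFinite μ] :
    AEStronglyMeasurable (fun q : E3 × ℝ => heatP f q.2 q.1) (volume.prod μ) := by
  have hm : AEStronglyMeasurable (fun q : (E3 × ℝ) × E3 => f q.2 * heatK q.1.2 (q.1.1 - q.2))
      ((volume.prod μ).prod volume) := by
    refine hf.1.comp_snd.mul (Measurable.aestronglyMeasurable ?_)
    exact measurable_heatK.comp (g := fun q : ℝ × E3 => heatK q.1 q.2)
      (f := fun q : (E3 × ℝ) × E3 => (q.1.2, q.1.1 - q.2)) (by fun_prop)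
  exact hm.integral_prod_right'

lemma integrable_prod_mul_heatP {f g : E3 → ℝ} (hf : BddL1 f) (hg : Integrable g) :
    Integrable (fun q : E3 × ℝ => g q.1 * heatP f q.2 q.1)
      (volume.prod (volume.restrict (Set.Ioi 0))) := by
  obtain ⟨b, hb, hfb⟩ := exists_heatP_bound hf
  refine (hg.abs.mul_prod hb).mono' (hg.1.comp_fst.mul (aestronglyMeasurable_heatP hf.1 _)) ?_
  filter_upwards [Measure.quasiMeasurePreserving_snd.ae (ae_restrict_mem measurableSet_Ioi)]
    with q hq
  rw [norm_mul]
  exact mul_le_mul_of_nonneg_left ((abs_heatP_le_heatP_abs f hq _).trans (hfb _ hq _))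
    (norm_nonneg _)

lemma integral_mul_newt {f g : E3 → ℝ} (hf : BddL1 f) (hg : Integrable g) :
    ∫ x, g x * newt f x = ∫ t in Set.Ioi (0 : ℝ), ∫ x, g x * heatP f t x := by
  rw [← integral_integral_swap (f := fun x t => g x * heatP f t x)
    (integrable_prod_mul_heatP hf hg)]
  simp_rw [integral_const_mul, newt_eq hf]

lemma heatP_newt {f : E3 → ℝ} (hf : BddL1 f) {t : ℝ} (ht : 0 < t) (x : E3) :
    heatP (newt f) t x = ∫ s in Set.Ioi t, heatP f s x := by
  have h := integral_mul_newt hf (integrable_heatK_sub ht x)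
  have e : ∫ s in Set.Ioi (0 : ℝ), ∫ z, heatK t (x - z) * heatP f s z =
      ∫ s in Set.Ioi (0 : ℝ), heatP f (t + s) x := by
    refine setIntegral_congr_fun measurableSet_Ioi fun s hs => ?_
    rw [← heatP_heatP hf.1 hs ht x, heatP]
    simp_rw [mul_comm]
  have e2 := (measurePreserving_add_left volume t).setIntegral_preimage_emb
    (measurableEmbedding_addLeft t) (fun s => heatP f s x) (Set.Ioi t)
  rw [Set.preimage_const_add_Ioi, sub_self] at e2
  rw [← e2, ← e, ← h, heatP]
  simp_rw [mul_comm]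

lemma integrable_mul_newt {f g : E3 → ℝ} (hf : BddL1 f) (hg : Integrable g) :
    Integrable fun x => g x * newt f x := by
  obtain ⟨M, -, hM⟩ := exists_abs_newt_le hf
  exact hg.mul_bdd (continuous_newt hf).aestronglyMeasurable (.of_forall hM)

lemma integral_mul_newt_comm {f g : E3 → ℝ} (hf : BddL1 f) (hg : BddL1 g) :
    ∫ x, g x * newt f x = ∫ x, f x * newt g x := by
  rw [integral_mul_newt hf hg.1, integral_mul_newt hg hf.1]
  exact setIntegral_congr_fun measurableSet_Ioi fun t ht => integral_mul_heatP_comm hg.1 hf.1 ht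

lemma newt_add_mul {f g : E3 → ℝ} (hf : BddL1 f) (hg : BddL1 g) (c : ℝ) (x : E3) :
    newt (fun y => f y + c * g y) x = newt f x + c * newt g x := by
  unfold newt
  rw [← integral_const_mul, ← integral_add (integrable_mul_coul hf x)
    ((integrable_mul_coul hg x).const_mul c)]
  congr with y
  ring

lemma energy_add_mul {f g : E3 → ℝ} (hf : BddL1 f) (hg : BddL1 g) (c : ℝ) :
    ∫ x, (f x + c * g x) * newt (fun y => f y + c * g y) x =
      (∫ x, f x * newt f x) + 2 * c * (∫ x, g x * newt f x) + c ^ 2 * ∫ x, g x * newt g x := by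
  have e : ∀ x, (f x + c * g x) * newt (fun y => f y + c * g y) x =
      f x * newt f x + c * (g x * newt f x) + (c * (f x * newt g x) +
        c ^ 2 * (g x * newt g x)) := fun x => by
    rw [newt_add_mul hf hg]; ring
  have i1 := integrable_mul_newt hf hf.1
  have i2 := (integrable_mul_newt hf hg.1).const_mul c
  have i3 := (integrable_mul_newt hg hf.1).const_mul c
  have i4 := (integrable_mul_newt hg hg.1).const_mul (c ^ 2)
  simp_rw [e]
  have i12 : Integrable fun x => f x * newt f x + c * (g x * newt f x) := i1.add i2
  have i34 : Integrable fun x => c * (f x * newt g x) + c ^ 2 * (g x * newt g x) := i3.add i4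
  rw [integral_add i12 i34, integral_add i1 i2, integral_add i3 i4,
    integral_const_mul, integral_const_mul, integral_const_mul, integral_mul_newt_comm hg hf]
  ring

lemma integral_mul_heatP_self {f : E3 → ℝ} (hf : BddL1 f) {t : ℝ} (ht : 0 < t) :
    ∫ x, f x * heatP f t x = ∫ x, heatP f (t / 2) x ^ 2 := by
  have h2 : 0 < t / 2 := by positivity
  have h := integral_mul_heatP_comm hf.1 (bddL1_heatP hf.1 h2).1 h2
  simp_rw [heatP_heatP hf.1 h2 h2, add_halves] at h
  rw [h]
  simp_rw [sq]

lemma tendsto_heatP_nhds_zero {f : E3 → ℝ} (hf : Integrable f) {x : E3} (hx : ContinuousAt f x) :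
    Tendsto (fun t => heatP f t x) (𝓝[>] 0) (𝓝 (f x)) := by
  have h := tendsto_integral_comp_smul_smul_of_integrable' (μ := (volume : Measure E3))
    (fun z => (heatK_pos one_pos z).le) (integral_heatK one_pos)
    (by simpa only [finrank_euclideanSpace, Fintype.card_fin] using
      tendsto_heatK_cobounded one_pos 3) hf hx
  have h0 : Tendsto (fun t : ℝ => (√t)⁻¹) (𝓝[>] 0) atTop := by
    refine tendsto_inv_nhdsGT_zero.comp (tendsto_nhdsWithin_iff.2 ⟨?_, ?_⟩)
    · have := (continuous_sqrt.tendsto 0).mono_left (nhdsWithin_le_nhds (s := Set.Ioi 0))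
      simpa using this
    · filter_upwards [self_mem_nhdsWithin] with t ht
      exact sqrt_pos.2 ht
  refine (h.comp h0).congr' ?_
  filter_upwards [self_mem_nhdsWithin] with t ht
  have ht : 0 < t := ht
  simp only [Function.comp, heatP, smul_eq_mul, finrank_euclideanSpace, Fintype.card_fin]
  refine integral_congr_ae (.of_forall fun y => ?_)
  have hs : 0 < √t := sqrt_pos.2 ht
  have e : (4 * π * t) ^ (-(3 / 2) : ℝ) = (√t)⁻¹ ^ 3 * (4 * π) ^ (-(3 / 2) : ℝ) := by
    rw [mul_rpow (by positivity) ht.le, mul_comm, sqrt_eq_rpow, ← rpow_neg ht.le, ← rpow_natCast,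
      ← rpow_mul ht.le]
    norm_num
  have e2 : -‖(√t)⁻¹ • (x - y)‖ ^ 2 / (4 * 1) = -‖x - y‖ ^ 2 / (4 * t) := by
    rw [norm_smul, mul_pow, norm_inv, inv_pow, norm_eq_abs, sq_abs, sq_sqrt ht.le]
    field_simp
  beta_reduce
  unfold heatK
  rw [e, e2]
  ring_nf

lemma heatP_mono_ae {f g : E3 → ℝ} (hf : Integrable f) (hg : Integrable g) (h : ∀ᵐ x, f x ≤ g x)
    {t : ℝ} (ht : 0 < t) (x : E3) : heatP f t x ≤ heatP g t x := by
  refine integral_mono_ae (integrable_mul_heatK hf ht x) (integrable_mul_heatK hg ht x) ?_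
  filter_upwards [h] with y hy
  exact mul_le_mul_of_nonneg_right hy (heatK_pos ht _).le

lemma coul_nonneg (x y : E3) : 0 ≤ coul x y := by
  unfold coul; positivity

lemma newt_nonneg_of_nonneg {f : E3 → ℝ} (hf : ∀ x, 0 ≤ f x) (x : E3) : 0 ≤ newt f x :=
  integral_nonneg fun y => mul_nonneg (hf y) (coul_nonneg x y)

lemma bddL1_heatK {t : ℝ} (ht : 0 < t) : BddL1 (heatK t) :=
  ⟨integrable_heatK ht, _, .of_forall fun z => norm_heatK_le ht z⟩

/-- A negative value of the potential cannot be a global minimum if the charge is positive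
around it. -/
lemma not_isMin_newt {f : E3 → ℝ} (hf : BddL1 f) {x₀ : E3} {U : Set E3} (hU : U ∈ 𝓝 x₀)
    (hpos : ∀ᵐ x, x ∈ U → heatK 1 x ≤ f x) : ¬ ∀ x, newt f x₀ ≤ newt f x := by
  classical
  intro hmin
  obtain ⟨V, hVU, hV, hxV⟩ := mem_nhds_iff.1 hU
  let g : E3 → ℝ := V.piecewise (heatK 1) f
  have hg : Integrable g :=
    Integrable.piecewise hV.measurableSet (integrable_heatK one_pos).integrableOn
      hf.1.integrableOn
  have hgx : g x₀ = heatK 1 x₀ := Set.piecewise_eq_of_mem _ _ _ hxV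
  have hgc : ContinuousAt g x₀ := by
    refine (continuous_heatK 1).continuousAt.congr ?_
    filter_upwards [hV.mem_nhds hxV] with y hy
    exact (Set.piecewise_eq_of_mem _ _ _ hy).symm
  have hgf : ∀ᵐ x, g x ≤ f x := by
    filter_upwards [hpos] with y hy
    by_cases hyV : y ∈ V
    · rw [show g y = heatK 1 y from Set.piecewise_eq_of_mem _ _ _ hyV]
      exact hy (hVU hyV)
    · exact (Set.piecewise_eq_of_notMem _ _ _ hyV).le
  have hev := (tendsto_heatP_nhds_zero hg hgc).eventually
    (lt_mem_nhds (by rw [hgx]; exact heatK_pos one_pos x₀))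
  obtain ⟨t, ht, hts⟩ := (nhdsGT_basis (0 : ℝ)).mem_iff.1 hev
  have ht2 : 0 < t / 2 := half_pos ht
  have hpos' : ∀ s ∈ Set.Ioc 0 (t / 2), 0 < heatP f s x₀ := fun s hs =>
    (show 0 < heatP g s x₀ from hts ⟨hs.1, by linarith [hs.2]⟩).trans_le
      (heatP_mono_ae hg hf.1 hgf hs.1 x₀)
  have hI := integrableOn_heatP hf x₀
  have hsplit : newt f x₀ = (∫ s in Set.Ioc 0 (t / 2), heatP f s x₀) +
      heatP (newt f) (t / 2) x₀ := by
    rw [newt_eq hf, heatP_newt hf ht2, ← Set.Ioc_union_Ioi_eq_Ioi ht2.le,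
      setIntegral_union (by rw [Set.disjoint_left]; exact fun s h1 h2 => h1.2.not_gt h2)
        measurableSet_Ioi (hI.mono_set Set.Ioc_subset_Ioi_self)
        (hI.mono_set (Set.Ioi_subset_Ioi ht2.le))]
  have h1 : 0 < ∫ s in Set.Ioc 0 (t / 2), heatP f s x₀ := by
    rw [← intervalIntegral.integral_of_le ht2.le]
    refine intervalIntegral.intervalIntegral_pos_of_pos_on ?_
      (fun s hs => hpos' s (Set.Ioo_subset_Ioc_self hs)) ht2
    rw [intervalIntegrable_iff_integrableOn_Ioc_of_le ht2.le]
    exact hI.mono_set Set.Ioc_subset_Ioi_self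
  have h2 : newt f x₀ ≤ heatP (newt f) (t / 2) x₀ := by
    obtain ⟨M, -, hM⟩ := exists_abs_newt_le hf
    have : ∫ y, newt f x₀ * heatK (t / 2) (x₀ - y) = newt f x₀ := by
      rw [integral_const_mul, integral_heatK_sub ht2, mul_one]
    rw [← this, heatP]
    refine integral_mono ((integrable_heatK_sub ht2 x₀).const_mul _)
      ((integrable_heatK_sub ht2 x₀).bdd_mul (continuous_newt hf).aestronglyMeasurable
        (.of_forall hM)) fun y => ?_
    exact mul_le_mul_of_nonneg_right (hmin y) (heatK_pos ht2 _).le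
  linarith

/-- Minimum principle: a potential whose charge is nonnegative wherever the potential is negative
is nonnegative. -/
lemma newt_nonneg {f : E3 → ℝ} (hf : BddL1 f) (h : ∀ᵐ x, newt f x < 0 → 0 ≤ f x) (x : E3) :
    0 ≤ newt f x := by
  by_contra! hx
  have hρ := bddL1_heatK one_pos
  obtain ⟨M, hM0, hM⟩ := exists_abs_newt_le hρ
  have hρ0 := newt_nonneg_of_nonneg fun z => (heatK_pos one_pos z).le
  obtain ⟨ε, hε, hεM⟩ : ∃ ε, 0 < ε ∧ newt f x + ε * M < 0 := by
    refine ⟨-newt f x / (M + 1), div_pos (by linarith) (by linarith), ?_⟩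
    have : -newt f x / (M + 1) * M = -newt f x - -newt f x / (M + 1) := by
      field_simp; ring
    have : 0 < -newt f x / (M + 1) := div_pos (by linarith) (by linarith)
    linarith
  let g : E3 → ℝ := fun y => ε⁻¹ * f y + heatK 1 y
  have hg : BddL1 g := (hf.const_mul _).add hρ
  have hgn : ∀ y, newt g y = ε⁻¹ * newt f y + newt (heatK 1) y := fun y => by
    have := newt_add_mul hρ hf ε⁻¹ y
    rw [add_comm, ← this]
    congr with z
    exact add_comm _ _
  have hgx : newt g x < 0 := by
    have h1 : newt (heatK 1) x ≤ M := (le_abs_self _).trans (hM x)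
    have h2 : ε⁻¹ * (newt f x + ε * M) < 0 := mul_neg_of_pos_of_neg (inv_pos.2 hε) hεM
    rw [mul_add, inv_mul_cancel_left₀ hε.ne'] at h2
    rw [hgn]
    linarith
  obtain ⟨x₀, hx₀⟩ := (continuous_newt hg).exists_forall_le' x
    (((tendsto_newt_cocompact hg).eventually (lt_mem_nhds hgx)).mono fun _ hy => hy.le)
  have hfx₀ : newt f x₀ < 0 := by
    have h1 : newt g x₀ < 0 := (hx₀ x).trans_lt hgx
    rw [hgn] at h1
    by_contra! h2
    have := mul_nonneg (inv_pos.2 hε).le h2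
    linarith [hρ0 x₀]
  refine not_isMin_newt hg
    ((continuous_newt hf).continuousAt.eventually (gt_mem_nhds hfx₀)) ?_ hx₀
  filter_upwards [h] with y hy hyU
  have := mul_nonneg (inv_pos.2 hε).le (hy hyU)
  simp only [g]
  linarith

lemma ae_eq_zero_of_energy_nonpos {f : E3 → ℝ} (hf : BddL1 f) (h : ∫ x, f x * newt f x ≤ 0) :
    f =ᵐ[volume] 0 := by
  have hI : IntegrableOn (fun t => ∫ x, f x * heatP f t x) (Set.Ioi 0) :=
    (integrable_prod_mul_heatP hf hf.1).integral_prod_right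
  have hnn : 0 ≤ᵐ[volume.restrict (Set.Ioi (0 : ℝ))] fun t => ∫ x, f x * heatP f t x := by
    filter_upwards [ae_restrict_mem measurableSet_Ioi] with t ht
    rw [integral_mul_heatP_self hf ht]
    exact integral_nonneg fun x => sq_nonneg _
  rw [integral_mul_newt hf hf.1] at h
  have h0 := (integral_eq_zero_iff_of_nonneg_ae hnn hI).1 (h.antisymm (integral_nonneg_of_ae hnn))
  have hP : ∀ᵐ t, t ∈ Set.Ioi (0 : ℝ) → heatP f (t / 2) =ᵐ[volume] 0 := by
    filter_upwards [(ae_restrict_iff' measurableSet_Ioi).1 h0] with t htt ht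
    have ht2 : 0 < t / 2 := half_pos ht
    have h1 := htt ht
    rw [integral_mul_heatP_self hf ht, Pi.zero_apply,
      integral_eq_zero_iff_of_nonneg (fun x => sq_nonneg _)] at h1
    · filter_upwards [h1] with x hx
      exact pow_eq_zero_iff two_ne_zero |>.1 hx
    · simp_rw [sq]
      obtain ⟨hi, B, hB⟩ := bddL1_heatP hf.1 ht2
      exact hi.mul_bdd hi.1 hB
  have hdense := Measure.dense_of_ae hP
  refine ae_eq_zero_of_integral_contDiff_smul_eq_zero hf.1.locallyIntegrable fun g hg hgc => ?_
  have hgi : Integrable g := hg.continuous.integrable_of_hasCompactSupport hgc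
  obtain ⟨C, hC⟩ := hg.continuous.bounded_above_of_compact_support hgc
  have hlim : Tendsto (fun t => ∫ x, f x * heatP g t x) (𝓝[>] 0) (𝓝 (∫ x, f x * g x)) := by
    refine tendsto_integral_filter_of_dominated_convergence (fun x => |f x| * C) ?_ ?_
      (hf.1.abs.mul_const _) (.of_forall fun x => ?_)
    · filter_upwards [self_mem_nhdsWithin] with t ht
      exact hf.1.1.mul (continuous_heatP hgi ht).aestronglyMeasurable
    · filter_upwards [self_mem_nhdsWithin] with t ht
      refine .of_forall fun x => ?_
      rw [norm_mul]
      refine mul_le_mul_of_nonneg_left ?_ (norm_nonneg _)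
      refine (abs_heatP_le_heatP_abs g ht x).trans ?_
      rw [← mul_one C, ← integral_heatK_sub ht x, ← integral_const_mul]
      refine integral_mono (integrable_mul_heatK hgi.abs ht x)
        ((integrable_heatK_sub ht x).const_mul _) fun y => ?_
      exact mul_le_mul_of_nonneg_right (hC y) (heatK_pos ht _).le
    · exact (tendsto_heatP_nhds_zero hgi hg.continuous.continuousAt).const_mul _
  have hfreq : ∃ᶠ t in 𝓝[>] (0 : ℝ), ∫ x, f x * heatP g t x ∈ ({0} : Set ℝ) := by
    rw [(nhdsGT_basis (0 : ℝ)).frequently_iff]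
    intro ε hε
    obtain ⟨s, hs, hsP⟩ := hdense.exists_mem_open isOpen_Ioo
      (Set.nonempty_Ioo.2 (show (0 : ℝ) < ε from hε))
    refine ⟨s / 2, ⟨half_pos hsP.1, by linarith [hsP.1, hsP.2]⟩, ?_⟩
    rw [Set.mem_singleton_iff, integral_mul_heatP_comm hf.1 hgi (half_pos hsP.1)]
    refine integral_eq_zero_of_ae ?_
    filter_upwards [hs hsP.1] with x hx
    simp [hx]
  have := isClosed_singleton.mem_of_frequently_of_tendsto hfreq hlim
  simpa [mul_comm] using this

lemma tendsto_heatP_atTop {f : E3 → ℝ} (hf : Integrable f) (x : E3) :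
    Tendsto (fun t => (4 * π * t) ^ (3 / 2 : ℝ) * heatP f t x) atTop (𝓝 (∫ y, f y)) := by
  have h : Tendsto (fun t => ∫ y, f y * exp (-‖x - y‖ ^ 2 / (4 * t))) atTop (𝓝 (∫ y, f y)) := by
    refine tendsto_integral_filter_of_dominated_convergence (fun y => |f y|) ?_ ?_ hf.abs
      (.of_forall fun y => ?_)
    · exact .of_forall fun t => hf.1.mul (Continuous.aestronglyMeasurable (by fun_prop))
    · filter_upwards [eventually_gt_atTop 0] with t ht
      refine .of_forall fun y => ?_
      rw [norm_mul, norm_eq_abs, norm_eq_abs, abs_exp]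
      refine mul_le_of_le_one_right (abs_nonneg _) (exp_le_one_iff.2 ?_)
      rw [neg_div]
      exact neg_nonpos.2 (by positivity)
    · have h1 : Tendsto (fun t : ℝ => -‖x - y‖ ^ 2 / (4 * t)) atTop (𝓝 0) :=
        tendsto_const_nhds.div_atTop (tendsto_id.const_mul_atTop (by norm_num))
      simpa using ((continuous_exp.tendsto 0).comp h1).const_mul (f y)
  refine h.congr' ?_
  filter_upwards [eventually_gt_atTop 0] with t ht
  rw [heatP, ← integral_const_mul]
  refine integral_congr_ae (.of_forall fun y => ?_)
  have : (4 * π * t) ^ (3 / 2 : ℝ) * (4 * π * t) ^ (-(3 / 2) : ℝ) = 1 := by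
    rw [← rpow_add (by positivity)]; norm_num
  simp only [heatK]
  linear_combination (-(f y * exp (-‖x - y‖ ^ 2 / (4 * t)))) * this

lemma exists_le_heatP_newt {f : E3 → ℝ} (hf : BddL1 f) (h : 0 < ∫ x, f x) (x : E3) :
    ∃ a, 0 < a ∧ ∀ᶠ t in atTop, a * t ^ (-(1 / 2) : ℝ) ≤ heatP (newt f) t x := by
  set c := ∫ x, f x
  have hev := (tendsto_heatP_atTop hf.1 x).eventually (lt_mem_nhds (half_lt_self h))
  obtain ⟨S, hS⟩ := eventually_atTop.1 hev
  refine ⟨c * (4 * π) ^ (-(3 / 2) : ℝ), by positivity, ?_⟩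
  filter_upwards [eventually_gt_atTop 0, eventually_ge_atTop S] with t ht htS
  rw [heatP_newt hf ht]
  have hi := integral_Ioi_rpow_of_lt (a := -(3 / 2)) (by norm_num) ht
  have e : c * (4 * π) ^ (-(3 / 2) : ℝ) * t ^ (-(1 / 2) : ℝ) =
      ∫ s in Set.Ioi t, c / 2 * (4 * π) ^ (-(3 / 2) : ℝ) * s ^ (-(3 / 2) : ℝ) := by
    rw [integral_const_mul, hi]
    norm_num
    ring
  rw [e]
  refine setIntegral_mono_on
    ((integrableOn_Ioi_rpow_of_lt (by norm_num) ht).const_mul _)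
    ((integrableOn_heatP hf x).mono_set (Set.Ioi_subset_Ioi ht.le)) measurableSet_Ioi
    fun s hs => ?_
  have hs0 : 0 < s := ht.trans hs
  have h1 := (hS s (htS.trans (le_of_lt hs))).le
  have h2 := mul_le_mul_of_nonneg_left h1
    (rpow_nonneg (by positivity : 0 ≤ 4 * π * s) (-(3 / 2)))
  have h3 : (4 * π * s) ^ (-(3 / 2) : ℝ) * (4 * π * s) ^ (3 / 2 : ℝ) = 1 := by
    rw [← rpow_add (by positivity)]; norm_num
  rw [← mul_assoc, h3, one_mul, mul_rpow (by positivity) hs0.le] at h2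
  linarith


/-- The charge density `χ_{Ω⁺} − u`. -/
def charge (Ωp : Set E3) (u : E3 → ℝ) (x : E3) : ℝ := Set.indicator Ωp (fun _ => (1 : ℝ)) x - u x

lemma relEnergy_eq (Ωp : Set E3) (u : E3 → ℝ) :
    relEnergy Ωp u = ∫ x, charge Ωp u x * newt (charge Ωp u) x := by
  unfold relEnergy newt charge
  simp_rw [integral_const_mul]

lemma RelAdm.bddL1 {Ωp : Set E3} {lam : ℝ} {u : E3 → ℝ} (hu : RelAdm Ωp lam u) : BddL1 u := by
  refine ⟨hu.1, 1, ?_⟩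
  filter_upwards [hu.2.1] with x hx
  rw [abs_of_nonneg hx.1]
  exact hx.2

lemma bddL1_indicator {Ωp : Set E3} (ho : IsOpen Ωp) (hfin : volume Ωp ≠ ⊤) :
    BddL1 (Ωp.indicator fun _ => (1 : ℝ)) := by
  refine ⟨(integrableOn_const hfin).integrable_indicator ho.measurableSet, 1, .of_forall fun x => ?_⟩
  by_cases hx : x ∈ Ωp <;> simp [hx]

/-- First-order condition for a minimizer in an admissible direction. -/
lemma integral_mul_newt_nonpos {Ωp : Set E3} {lam : ℝ} {u ψ : E3 → ℝ}
    (hc : BddL1 (charge Ωp u)) (hψ : BddL1 ψ)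
    (hmin : ∀ v, RelAdm Ωp lam v → relEnergy Ωp u ≤ relEnergy Ωp v) {ε₀ : ℝ} (hε₀ : 0 < ε₀)
    (hadm : ∀ ε, 0 < ε → ε ≤ ε₀ → RelAdm Ωp lam fun x => u x + ε * ψ x) :
    ∫ x, ψ x * newt (charge Ωp u) x ≤ 0 := by
  by_contra! hA
  set A := ∫ x, ψ x * newt (charge Ωp u) x
  set D := ∫ x, ψ x * newt ψ x with hD
  set ε := min ε₀ (A / (|D| + 1)) with hε
  have hε0 : 0 < ε := lt_min hε₀ (by positivity)
  have h := hmin _ (hadm ε hε0 (min_le_left _ _))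
  have e : charge Ωp (fun x => u x + ε * ψ x) = fun x => charge Ωp u x + (-ε) * ψ x := by
    funext x; simp only [charge]; ring
  rw [relEnergy_eq, relEnergy_eq, e, energy_add_mul hc hψ] at h
  have h2 : ε * (|D| + 1) ≤ A := (le_div_iff₀ (by positivity)).1 (min_le_right _ _)
  have h3 : 0 ≤ ε * (ε * D - 2 * A) := by linarith
  have h4 := nonneg_of_mul_nonneg_right h3 hε0
  nlinarith [mul_le_mul_of_nonneg_left (le_abs_self D) hε0.le]

/-- A minimizer never carries more mass than the fixed charge. -/
lemma integral_le_of_isMin {Ωp : Set E3} {lam : ℝ} {u : E3 → ℝ}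
    (hχ : BddL1 (Ωp.indicator fun _ => (1 : ℝ))) (hadm : RelAdm Ωp lam u)
    (hmin : ∀ v, RelAdm Ωp lam v → relEnergy Ωp u ≤ relEnergy Ωp v) :
    ∫ x, u x ≤ ∫ x, Ωp.indicator (fun _ => (1 : ℝ)) x := by
  have hc : BddL1 (charge Ωp u) := hχ.sub hadm.bddL1
  set φ := newt (charge Ωp u)
  have hS : MeasurableSet {x | φ x < 0} :=
    measurableSet_lt (continuous_newt hc).measurable measurable_const
  let ψ : E3 → ℝ := {x | φ x < 0}.indicator fun x => -u x
  have hψi : Integrable ψ := hadm.1.neg.indicator hS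
  have hψv : ∀ᵐ x, ψ x ≤ 0 ∧ -u x ≤ ψ x := by
    filter_upwards [hadm.2.1] with x hx
    by_cases h : φ x < 0 <;> simp [ψ, h, hx.1]
  have hψ : BddL1 ψ := by
    refine ⟨hψi, 1, ?_⟩
    filter_upwards [hψv, hadm.2.1] with x h1 h2
    rw [abs_of_nonpos h1.1]
    linarith
  have key : ∫ x, ψ x * φ x ≤ 0 := by
    refine integral_mul_newt_nonpos hc hψ hmin one_pos fun ε hε0 hε1 => ?_
    refine ⟨hadm.1.add (hψi.const_mul ε), ?_, ?_, ?_⟩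
    · filter_upwards [hψv, hadm.2.1] with x h1 h2
      constructor <;> nlinarith
    · filter_upwards [hψv, hadm.2.2.1] with x h1 h2 hx
      have h3 := h2 hx
      have : ψ x = 0 := by linarith
      rw [h3, this]; simp
    · refine (integral_mono_ae (hadm.1.add (hψi.const_mul ε)) hadm.1 ?_).trans hadm.2.2.2
      filter_upwards [hψv] with x h1
      have := mul_nonpos_of_nonneg_of_nonpos hε0.le h1.1
      simp only [Pi.add_apply]
      linarith
  have hnn : 0 ≤ᵐ[volume] fun x => ψ x * φ x := by
    filter_upwards [hψv] with x h1
    by_cases h : φ x < 0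
    · exact mul_nonneg_of_nonpos_of_nonpos h1.1 h.le
    · simp [ψ, h]
  have hzero := (integral_eq_zero_iff_of_nonneg_ae hnn (integrable_mul_newt hc hψi)).1
    (le_antisymm key (integral_nonneg_of_ae hnn))
  have hφ : ∀ x, 0 ≤ φ x := newt_nonneg hc (by
    filter_upwards [hzero] with x hx hneg
    have h2 : u x = 0 := by
      have hneg2 : φ x < 0 := hneg
      simpa [ψ, hneg2, hneg2.ne] using hx
    simp only [charge, h2, sub_zero]
    exact Set.indicator_nonneg (fun _ _ => zero_le_one) x)
  by_contra! hlt
  have hpos : 0 < ∫ x, (-1) * charge Ωp u x := by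
    rw [integral_const_mul, show ∫ x, charge Ωp u x = _ from integral_sub hχ.1 hadm.1]
    linarith
  obtain ⟨a, ha, hev⟩ := exists_le_heatP_newt (hc.const_mul (-1)) hpos 0
  obtain ⟨t, ht, ht0⟩ := (hev.and (eventually_gt_atTop 0)).exists
  have hle : heatP (newt fun x => (-1) * charge Ωp u x) t 0 ≤ 0 := by
    refine integral_nonpos fun y => mul_nonpos_of_nonpos_of_nonneg ?_ (heatK_pos ht0 _).le
    have : newt (fun x => (-1) * charge Ωp u x) y = -φ y := by
      simp only [φ, newt, ← integral_neg]
      congr with z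
      ring
    rw [this]
    exact neg_nonpos.2 (hφ y)
  have : 0 < a * t ^ (-(1 / 2) : ℝ) := by positivity
  linarith

/-- A minimizer exhausts either the constraint or the fixed charge. -/
lemma le_integral_of_isMin {Ωp : Set E3} {lam : ℝ} {u : E3 → ℝ}
    (hχ : BddL1 (Ωp.indicator fun _ => (1 : ℝ))) (hadm : RelAdm Ωp lam u)
    (hmin : ∀ v, RelAdm Ωp lam v → relEnergy Ωp u ≤ relEnergy Ωp v) (hlt : ∫ x, u x < lam) :
    ∫ x, Ωp.indicator (fun _ => (1 : ℝ)) x ≤ ∫ x, u x := by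
  by_contra! hlt2
  have hc : BddL1 (charge Ωp u) := hχ.sub hadm.bddL1
  set φ := newt (charge Ωp u)
  obtain ⟨M, hM0, hM⟩ := exists_abs_newt_le hc
  set χ : E3 → ℝ := Ωp.indicator fun _ => (1 : ℝ)
  have hχ0 : ∀ x, 0 ≤ χ x := Set.indicator_nonneg fun _ _ => zero_le_one
  have hv : ∀ᵐ x, 0 ≤ 1 - (χ x + u x) ∧ 0 ≤ χ x + u x := by
    filter_upwards [hadm.2.1, hadm.2.2.1] with x h1 h2
    by_cases hx : x ∈ Ωp
    · simp [χ, hx, h2 hx]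
    · simp [χ, hx, h1.1, h1.2]
  have hs : Integrable fun x => χ x + u x := hχ.1.add hadm.1
  have hbound : ∀ T : ℝ, 1 ≤ T →
      heatP φ T 0 ≤ (4 * π * T) ^ (-(3 / 2) : ℝ) * (M * ∫ x, (χ x + u x)) := by
    intro T hT
    have hT0 : 0 < T := by linarith
    have hK1 : ∀ z, heatK T z ≤ 1 := fun z => (heatK_le hT0 z).trans <|
      rpow_le_one_of_one_le_of_nonpos (by nlinarith [pi_gt_three]) (by norm_num)
    let ψ : E3 → ℝ := fun x => heatK T (0 - x) - (χ x + u x) * heatK T (0 - x)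
    have hψ1 : ∀ x, ψ x = (1 - (χ x + u x)) * heatK T (0 - x) := fun x => by simp only [ψ]; ring
    have hi1 := integrable_mul_heatK hs hT0 0
    have hψi : Integrable ψ := (integrable_heatK_sub hT0 0).sub hi1
    have hψv : ∀ᵐ x, 0 ≤ ψ x ∧ ψ x ≤ 1 - (χ x + u x) := by
      filter_upwards [hv] with x hx
      rw [hψ1]
      exact ⟨mul_nonneg hx.1 (heatK_pos hT0 _).le, mul_le_of_le_one_right hx.1 (hK1 _)⟩
    have hψ : BddL1 ψ := by
      refine ⟨hψi, 1, ?_⟩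
      filter_upwards [hψv, hv] with x h1 h2
      rw [abs_of_nonneg h1.1]
      linarith
    have hψ0 : 0 ≤ ∫ x, ψ x := integral_nonneg_of_ae (hψv.mono fun x hx => hx.1)
    have key : ∫ x, ψ x * φ x ≤ 0 := by
      refine integral_mul_newt_nonpos hc hψ hmin
        (ε₀ := min 1 ((lam - ∫ x, u x) / ((∫ x, ψ x) + 1)))
        (lt_min one_pos (div_pos (sub_pos.2 hlt) (by positivity))) fun ε hε0 hε => ?_
      have hε1 := hε.trans (min_le_left _ _)
      have hε2 := (le_div_iff₀ (by positivity)).1 (hε.trans (min_le_right _ _))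
      refine ⟨hadm.1.add (hψi.const_mul ε), ?_, ?_, ?_⟩
      · filter_upwards [hψv, hadm.2.1] with x h1 h2
        have h3 := hχ0 x
        constructor <;> nlinarith
      · filter_upwards [hψv, hadm.2.2.1] with x h1 h2 hx
        have h3 := h2 hx
        have h4 : χ x = 1 := by simp [χ, hx]
        have : ψ x = 0 := by linarith
        rw [h3, this]; simp
      · rw [integral_add hadm.1 (hψi.const_mul ε), integral_const_mul]
        linarith
    have hi2 := integrable_mul_newt hc (integrable_heatK_sub hT0 0)
    have hi3 := integrable_mul_newt hc hi1
    have e : ∫ x, ψ x * φ x = heatP φ T 0 - ∫ x, (χ x + u x) * heatK T (0 - x) * φ x := by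
      rw [heatP, show ∫ y, φ y * heatK T (0 - y) = ∫ y, heatK T (0 - y) * φ y by
        simp_rw [mul_comm], ← integral_sub hi2 hi3]
      simp only [ψ, sub_mul]
      rfl
    rw [e, sub_nonpos] at key
    refine key.trans ?_
    rw [← integral_const_mul, ← integral_const_mul]
    refine integral_mono_ae hi3 ((hs.const_mul _).const_mul _) ?_
    filter_upwards [hv] with x hx
    have h1 : φ x ≤ M := (le_abs_self _).trans (hM x)
    have h2 := heatK_le hT0 (0 - x)
    have h3 := (heatK_pos hT0 (0 - x)).le
    have h4 := hx.2
    calc (χ x + u x) * heatK T (0 - x) * φ x ≤ (χ x + u x) * heatK T (0 - x) * M := by gcongr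
      _ ≤ (χ x + u x) * (4 * π * T) ^ (-(3 / 2) : ℝ) * M := by gcongr
      _ = _ := by ring
  have hpos : 0 < ∫ x, charge Ωp u x := by
    rw [show ∫ x, charge Ωp u x = _ from integral_sub hχ.1 hadm.1]
    linarith
  obtain ⟨a, ha, hev⟩ := exists_le_heatP_newt hc hpos 0
  set C := (4 * π) ^ (-(3 / 2) : ℝ) * (M * ∫ x, (χ x + u x))
  obtain ⟨T, hT1, hT2, hT3⟩ :=
    (hev.and ((eventually_ge_atTop 1).and (eventually_gt_atTop (C / a)))).exists
  have hT0 : 0 < T := by linarith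
  have h := hT1.trans (hbound T hT2)
  have e1 : T ^ (-(1 / 2) : ℝ) = T ^ (-(3 / 2) : ℝ) * T := by
    rw [← rpow_add_one hT0.ne']; norm_num
  rw [mul_rpow (by positivity) hT0.le, e1] at h
  have h2 : T ^ (-(3 / 2) : ℝ) * (a * T) ≤ T ^ (-(3 / 2) : ℝ) * C := by
    simp only [C]; linarith
  have h3 := le_of_mul_le_mul_left h2 (by positivity)
  rw [div_lt_iff₀ ha] at hT3
  linarith

/-- The mass of a minimizer. -/
lemma integral_eq_min_of_isMin {Ωp : Set E3} {lam : ℝ} {u : E3 → ℝ}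
    (hχ : BddL1 (Ωp.indicator fun _ => (1 : ℝ))) (hadm : RelAdm Ωp lam u)
    (hmin : ∀ v, RelAdm Ωp lam v → relEnergy Ωp u ≤ relEnergy Ωp v) :
    ∫ x, u x = min lam (∫ x, Ωp.indicator (fun _ => (1 : ℝ)) x) := by
  refine le_antisymm (le_min hadm.2.2.2 (integral_le_of_isMin hχ hadm hmin)) ?_
  rcases hadm.2.2.2.lt_or_eq with h | h
  · exact (min_le_right _ _).trans (le_integral_of_isMin hχ hadm hmin h)
  · exact (min_le_left _ _).trans h.ge

lemma RelAdm.add_mul_sub {Ωp : Set E3} {lam : ℝ} {u v : E3 → ℝ} (hu : RelAdm Ωp lam u)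
    (hv : RelAdm Ωp lam v) {ε : ℝ} (h0 : 0 ≤ ε) (h1 : ε ≤ 1) :
    RelAdm Ωp lam fun x => u x + ε * (v x - u x) := by
  refine ⟨hu.1.add ((hv.1.sub hu.1).const_mul ε), ?_, ?_, ?_⟩
  · filter_upwards [hu.2.1, hv.2.1] with x hx hy
    constructor <;> nlinarith
  · filter_upwards [hu.2.2.1, hv.2.2.1] with x hx hy h
    simp [hx h, hy h]
  · have hi : Integrable fun x => ε * (v x - u x) := (hv.1.sub hu.1).const_mul ε
    rw [integral_add hu.1 hi, integral_const_mul, integral_sub hv.1 hu.1]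
    have := hu.2.2.2
    have := hv.2.2.2
    nlinarith

/-- Minimizers are unique up to null sets. -/
lemma ae_eq_of_isMin {Ωp : Set E3} {lam : ℝ} {u v : E3 → ℝ}
    (hχ : BddL1 (Ωp.indicator fun _ => (1 : ℝ))) (hu : RelAdm Ωp lam u) (hv : RelAdm Ωp lam v)
    (hmin : ∀ w, RelAdm Ωp lam w → relEnergy Ωp u ≤ relEnergy Ωp w)
    (hle : relEnergy Ωp v ≤ relEnergy Ωp u) : u =ᵐ[volume] v := by
  have hc : BddL1 (charge Ωp u) := hχ.sub hu.bddL1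
  have hψ : BddL1 fun x => v x - u x := hv.bddL1.sub hu.bddL1
  have key := integral_mul_newt_nonpos hc hψ hmin one_pos fun ε h0 h1 => hu.add_mul_sub hv h0.le h1
  have e : charge Ωp v = fun x => charge Ωp u x + (-1) * (v x - u x) := by
    funext x; simp only [charge]; ring
  rw [relEnergy_eq, relEnergy_eq, e, energy_add_mul hc hψ] at hle
  filter_upwards [ae_eq_zero_of_energy_nonpos hψ (by linarith)] with x hx
  exact (sub_eq_zero.1 hx).symm

/-- **Proposition 3.6** (Saturation of charges): the minimizer `u_λ` of the
relaxed problem has total mass `min {λ, m}`, and for `λ ≥ m` it coincides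
a.e. with the minimizer `u_m`. -/
theorem relaxed_saturation
    (Ωp : Set E3) (ho : IsOpen Ωp) (hb : Bornology.IsBounded Ωp)
    (m : ℝ) (hm : 0 < m) (hvol : volume Ωp = ENNReal.ofReal m)
    (lam : ℝ) (hlam : 0 < lam)
    (ulam : E3 → ℝ) (hadm : RelAdm Ωp lam ulam)
    (hmin : ∀ v, RelAdm Ωp lam v → relEnergy Ωp ulam ≤ relEnergy Ωp v)
    (um : E3 → ℝ) (hadmm : RelAdm Ωp m um)
    (hminm : ∀ v, RelAdm Ωp m v → relEnergy Ωp um ≤ relEnergy Ωp v) :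
    (∫ x, ulam x) = min lam m ∧ (m ≤ lam → ulam =ᵐ[volume] um) := by
  have hχ := bddL1_indicator ho (by rw [hvol]; exact ENNReal.ofReal_ne_top)
  have hmass : ∫ x, Ωp.indicator (fun _ => (1 : ℝ)) x = m := by
    rw [integral_indicator ho.measurableSet, setIntegral_const, Measure.real, hvol,
      ENNReal.toReal_ofReal hm.le, smul_eq_mul, mul_one]
  have hint := integral_eq_min_of_isMin hχ hadm hmin
  rw [hmass] at hint
  refine ⟨hint, fun hle => ?_⟩
  rw [min_eq_right hle] at hint
  exact ae_eq_of_isMin hχ hadm ⟨hadmm.1, hadmm.2.1, hadmm.2.2.1, hadmm.2.2.2.trans hle⟩ hmin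
    (hminm ulam ⟨hadm.1, hadm.2.1, hadm.2.2.1, hint.le⟩)
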